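/- Let n ≥ m ≥ 2 be integers with at least one of n, m odd. Then for every vertex v of the grid graph L_{n,m}, f_d(L_{n,m}, v) = n + m − 1. -/

import Mathlib

open SimpleGraph

variable {V : Type*}

/-- The eccentricity of a vertex: the maximum graph distance to any vertex. -/
noncomputable def ecc [Fintype V] (G : SimpleGraph V) (u : V) : ℕ :=
  Finset.univ.sup fun w => G.dist u w

/-- The diameter of a graph: the maximum eccentricity. -/
noncomputable def graphDiam [Fintype V] (G : SimpleGraph V) : ℕ :=
  Finset.univ.sup fun u => ecc G u

/-- A nonempty set `U` of vertices is closed if for every `u ∈ U` and every vertex `v`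
there is `x ∈ U` with `dist u v = dist u x`. -/
def IsClosedSet (G : SimpleGraph V) (U : Set V) : Prop :=
  U.Nonempty ∧ ∀ u ∈ U, ∀ v : V, ∃ x ∈ U, G.dist u v = G.dist u x

/-- An Explorer strategy (assigning a called distance to each history, most recent
vertex first) is valid if, whenever the current vertex `u` has a legal call available
(`1 ≤ ecc u`), it calls some `k` with `1 ≤ k ≤ ecc u`. -/
def EValid [Fintype V] (G : SimpleGraph V) (ES : List V → ℕ) : Prop :=
  ∀ h : List V, ∀ u : V, h.head? = some u → 1 ≤ ecc G u →
    1 ≤ ES h ∧ ES h ≤ ecc G u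

/-- A Director strategy is valid if, for each history with current vertex `u` and each
legal called distance `k` (`1 ≤ k ≤ ecc u`), it answers a vertex at distance exactly `k`. -/
def DValid [Fintype V] (G : SimpleGraph V) (DS : List V → ℕ → V) : Prop :=
  ∀ h : List V, ∀ u : V, h.head? = some u → ∀ k : ℕ, 1 ≤ k → k ≤ ecc G u →
    G.dist u (DS h k) = k

/-- The history (most recent vertex first) of the first `n` moves of the play determined
by Explorer strategy `ES` and Director strategy `DS`, starting at `v`. -/
def play (ES : List V → ℕ) (DS : List V → ℕ → V) (v : V) : ℕ → List V
  | 0 => [v]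
  | n + 1 => DS (play ES DS v n) (ES (play ES DS v n)) :: play ES DS v n

/-- The number of distinct vertices visited in the play determined by `ES` and `DS`
starting at `v`. -/
noncomputable def playScore (ES : List V → ℕ) (DS : List V → ℕ → V) (v : V) : ℕ :=
  Set.ncard {x : V | ∃ n : ℕ, x ∈ play ES DS v n}

/-- `fd G v` : the max over valid Explorer strategies of the min over valid Director
strategies of the number of distinct vertices visited. -/
noncomputable def fd [Fintype V] (G : SimpleGraph V) (v : V) : ℕ :=
  sSup {r : ℕ | ∃ ES : List V → ℕ, EValid G ES ∧
    r = sInf {s : ℕ | ∃ DS : List V → ℕ → V, DValid G DS ∧ s = playScore ES DS v}}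

/-- A play `x` is consistent with the nonadaptive strategy `S` from start `v` if it starts
at `v` and each step has the prescribed length. -/
def NAConsistent (G : SimpleGraph V) (S : List ℕ) (v : V) (x : ℕ → V) : Prop :=
  x 0 = v ∧ ∀ i < S.length, G.dist (x i) (x (i + 1)) = S.getD i 0

/-- A nonadaptive strategy is playable from `v` if every consistent initial segment
can be extended. -/
def NAPlayable (G : SimpleGraph V) (S : List ℕ) (v : V) : Prop :=
  ∀ x : ℕ → V, ∀ i < S.length, x 0 = v →
    (∀ j < i, G.dist (x j) (x (j + 1)) = S.getD j 0) →
    ∃ y : V, G.dist (x i) y = S.getD i 0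

/-- The score of a nonadaptive strategy `S` from `v`: the minimum over consistent plays
of the number of distinct vertices among `x 0, …, x S.length`. -/
noncomputable def naScore (G : SimpleGraph V) (S : List ℕ) (v : V) : ℕ :=
  sInf {k : ℕ | ∃ x : ℕ → V, NAConsistent G S v x ∧
    k = Set.ncard {w : V | ∃ i ≤ S.length, x i = w}}

/-- The `n × m` grid graph: the box product of two path graphs. -/
def gridGraph (n m : ℕ) : SimpleGraph (Fin n × Fin m) :=
  (pathGraph n) □ (pathGraph m)

section ExplorerDirector

lemma play_mono (ES : List V → ℕ) (DS : List V → ℕ → V) (v : V) {x : V} {i j : ℕ}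
    (hij : i ≤ j) (hx : x ∈ play ES DS v i) : x ∈ play ES DS v j := by
  induction hij with
  | refl => exact hx
  | step _ ih => exact List.mem_cons_of_mem _ ih

lemma exists_head?_play (ES : List V → ℕ) (DS : List V → ℕ → V) (v : V) (i : ℕ) :
    ∃ u, (play ES DS v i).head? = some u ∧ u ∈ play ES DS v i := by
  cases i <;> simp [play]

variable [Fintype V] {G : SimpleGraph V}

lemma dist_le_ecc (u w : V) : G.dist u w ≤ ecc G u :=
  Finset.le_sup (f := fun w => G.dist u w) (Finset.mem_univ w)

lemma exists_dist_eq_ecc (u : V) : ∃ w, G.dist u w = ecc G u := by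
  obtain ⟨w, -, hw⟩ := Finset.exists_mem_eq_sup Finset.univ ⟨u, Finset.mem_univ u⟩
    fun w => G.dist u w
  exact ⟨w, hw.symm⟩

/-- Finitely many moves suffice to see every vertex that the play ever visits. -/
lemma exists_play_complete (ES : List V → ℕ) (DS : List V → ℕ → V) (v : V) :
    ∃ N, ∀ i, ∀ x ∈ play ES DS v i, x ∈ play ES DS v N := by
  classical
  have h : ∀ x, ∃ N, ∀ i, x ∈ play ES DS v i → x ∈ play ES DS v N := fun x => by
    by_cases hx : ∃ N, x ∈ play ES DS v N
    · exact hx.imp fun N hN _ _ => hN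
    · exact ⟨0, fun i hi => (hx ⟨i, hi⟩).elim⟩
  choose f hf using h
  exact ⟨Finset.univ.sup f, fun i x hx =>
    play_mono _ _ _ (Finset.le_sup (Finset.mem_univ x)) (hf x i hx)⟩

lemma sInf_playScore_le {DS : List V → ℕ → V} (hDS : DValid G DS) (ES : List V → ℕ) (v : V) :
    sInf {s : ℕ | ∃ DS : List V → ℕ → V, DValid G DS ∧ s = playScore ES DS v} ≤
      playScore ES DS v :=
  Nat.sInf_le ⟨DS, hDS, rfl⟩

/-- If the start lies in a set in which every legal call can be answered, the Director can
confine the play to that set. -/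
lemma fd_le_ncard {U : Set V} {v : V} (hv : v ∈ U) (hpos : ∀ u, 1 ≤ ecc G u)
    (hU : ∀ u ∈ U, ∀ k ≤ ecc G u, ∃ x ∈ U, G.dist u x = k)
    (hall : ∀ u, ∀ k ≤ ecc G u, ∃ x, G.dist u x = k) : fd G v ≤ U.ncard := by
  classical
  have hanswer : ∀ u k, ∃ x, k ≤ ecc G u → G.dist u x = k ∧ (u ∈ U → x ∈ U) := fun u k => by
    by_cases hk : k ≤ ecc G u
    · by_cases hu : u ∈ U
      · obtain ⟨x, hx, hd⟩ := hU u hu k hk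
        exact ⟨x, fun _ => ⟨hd, fun _ => hx⟩⟩
      · obtain ⟨x, hd⟩ := hall u k hk
        exact ⟨x, fun _ => ⟨hd, fun h => (hu h).elim⟩⟩
    · exact ⟨u, fun h => (hk h).elim⟩
  choose a ha using hanswer
  let DS : List V → ℕ → V := fun h k => a (h.head?.getD v) k
  have hDS : DValid G DS := fun h u hu k _ hk => by
    simpa [DS, hu] using (ha u k hk).1
  refine csSup_le' ?_
  rintro _ ⟨ES, hES, rfl⟩
  refine (sInf_playScore_le hDS ES v).trans (Set.ncard_le_ncard ?_ U.toFinite)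
  rintro x ⟨i, hx⟩
  induction i generalizing x with
  | zero => simp_all [play]
  | succ i ih =>
    rcases List.mem_cons.1 hx with rfl | hx
    · obtain ⟨u, hu, hmem⟩ := exists_head?_play ES DS v i
      simp only [DS, hu, Option.getD_some]
      exact (ha u _ (hES _ u hu (hpos u)).2).2 (ih hmem)
    · exact ih hx

/-- If every vertex at maximal distance from some vertex has eccentricity at least `c`, the
Explorer can force `c + 1` vertices: call a distance not yet realised from the current vertex
if there is one, and the eccentricity otherwise. -/
lemma succ_le_fd {c : ℕ} (v : V) (hpos : ∀ u, 1 ≤ ecc G u)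
    (hall : ∀ u, ∀ k ≤ ecc G u, ∃ x, G.dist u x = k)
    (hfar : ∀ u w, G.dist u w = ecc G u → c ≤ ecc G w) : c + 1 ≤ fd G v := by
  classical
  have hcall : ∀ (h : List V) (u : V), ∃ k, 1 ≤ k ∧ k ≤ ecc G u ∧
      ((∀ x ∈ h, G.dist u x ≠ k) ∨
        (k = ecc G u ∧ ∀ j, 1 ≤ j → j ≤ ecc G u → ∃ x ∈ h, G.dist u x = j)) := fun h u => by
    by_cases hk : ∃ k, 1 ≤ k ∧ k ≤ ecc G u ∧ ∀ x ∈ h, G.dist u x ≠ k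
    · obtain ⟨k, h1, h2, h3⟩ := hk
      exact ⟨k, h1, h2, Or.inl h3⟩
    · push Not at hk
      exact ⟨_, hpos u, le_rfl, Or.inr ⟨rfl, hk⟩⟩
  choose e he using hcall
  let ES : List V → ℕ := fun h => e h (h.head?.getD v)
  have hES : EValid G ES := fun h u hu _ => by
    simpa [ES, hu] using And.intro (he h u).1 (he h u).2.1
  have hbdd : BddAbove {r : ℕ | ∃ ES : List V → ℕ, EValid G ES ∧
      r = sInf {s : ℕ | ∃ DS : List V → ℕ → V, DValid G DS ∧ s = playScore ES DS v}} := by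
    choose a ha using hall
    let DS : List V → ℕ → V := fun h k =>
      if hk : k ≤ ecc G (h.head?.getD v) then a _ k hk else v
    have hDS : DValid G DS := fun h u hu k _ hk => by simp [DS, hu, hk, ha]
    refine ⟨Fintype.card V, ?_⟩
    rintro _ ⟨ES, -, rfl⟩
    refine (sInf_playScore_le hDS ES v).trans ?_
    rw [← Nat.card_eq_fintype_card]
    exact Set.ncard_le_card _
  have hne : {s : ℕ | ∃ DS : List V → ℕ → V, DValid G DS ∧ s = playScore ES DS v}.Nonempty := by
    choose a ha using hall
    refine ⟨_, fun h k => if hk : k ≤ ecc G (h.head?.getD v) then a _ k hk else v, ?_, rfl⟩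
    intro h u hu k _ hk
    simp [hu, hk, ha]
  refine le_trans ?_ (le_csSup hbdd ⟨ES, hES, rfl⟩)
  obtain ⟨DS, hDS, hs⟩ := Nat.sInf_mem hne
  rw [hs]
  obtain ⟨N, hN⟩ := exists_play_complete ES DS v
  have hstep : ∀ i, N ≤ i → ∀ u, (play ES DS v i).head? = some u →
      ES (play ES DS v i) = ecc G u ∧
        ∀ j, 1 ≤ j → j ≤ ecc G u → ∃ x ∈ play ES DS v i, G.dist u x = j := fun i hi u hu => by
    have hES' : ES (play ES DS v i) = e (play ES DS v i) u := by simp [ES, hu]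
    obtain ⟨h1, h2, h3⟩ := he (play ES DS v i) u
    rcases h3 with h3 | ⟨h3, h4⟩
    · refine (h3 _ (play_mono ES DS v hi (hN (i + 1) _ List.mem_cons_self)) ?_).elim
      rw [hES']
      exact hDS _ u hu _ h1 h2
    · exact ⟨hES'.trans h3, h4⟩
  obtain ⟨u, hu, -⟩ := exists_head?_play ES DS v N
  obtain ⟨w, hw, hwmem⟩ := exists_head?_play ES DS v (N + 1)
  have huw : G.dist u w = ecc G u := by
    have hw' : DS (play ES DS v N) (ES (play ES DS v N)) = w := by simpa [play] using hw
    rw [← hw', (hstep N le_rfl u hu).1]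
    exact hDS _ u hu _ (hpos u) le_rfl
  have hc := hfar u w huw
  have hsub : ((Finset.range (c + 1) : Finset ℕ) : Set ℕ) ⊆
      G.dist w '' {x : V | ∃ i : ℕ, x ∈ play ES DS v i} := fun j hj => by
    have hj' : j ≤ c := by simpa [Nat.lt_succ_iff] using hj
    rcases Nat.eq_zero_or_pos j with rfl | h0
    · exact ⟨w, ⟨_, hwmem⟩, dist_self⟩
    · obtain ⟨x, hx, hd⟩ := (hstep (N + 1) (Nat.le_succ N) w hw).2 j h0 (hj'.trans hc)
      exact ⟨x, ⟨_, hx⟩, hd⟩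
  calc c + 1 = ((Finset.range (c + 1) : Finset ℕ) : Set ℕ).ncard := by
        rw [Set.ncard_coe_finset, Finset.card_range]
    _ ≤ _ := Set.ncard_le_ncard hsub (Set.toFinite _)
    _ ≤ playScore ES DS v := Set.ncard_image_le (Set.toFinite _)

end ExplorerDirector

section Grid

lemma pathGraph_dist {n : ℕ} (u v : Fin n) :
    (pathGraph n).dist u v = (u.1 - v.1) + (v.1 - u.1) := by
  have hupper : ∀ d : ℕ, ∀ u v : Fin n, u.1 + d = v.1 →
      ∃ p : (pathGraph n).Walk u v, p.length = d := by
    intro d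
    induction d with
    | zero =>
      intro u v h
      obtain rfl : u = v := Fin.ext h
      exact ⟨.nil, rfl⟩
    | succ d ih =>
      intro u v h
      obtain ⟨p, hp⟩ := ih ⟨u.1 + 1, by omega⟩ v (by simp; omega)
      exact ⟨.cons (pathGraph_adj.2 (Or.inl rfl)) p, by simp [hp]⟩
  have hlower : ∀ {u v : Fin n} (p : (pathGraph n).Walk u v),
      (u.1 - v.1) + (v.1 - u.1) ≤ p.length := by
    intro u v p
    induction p with
    | nil => simp
    | cons h p ih =>
      rw [pathGraph_adj] at h
      rw [Walk.length_cons]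
      omega
  apply le_antisymm
  · rcases le_total u.1 v.1 with h | h
    · obtain ⟨p, hp⟩ := hupper (v.1 - u.1) u v (by omega)
      exact (dist_le p).trans (by omega)
    · obtain ⟨p, hp⟩ := hupper (u.1 - v.1) v u (by omega)
      rw [dist_comm]
      exact (dist_le p).trans (by omega)
  · obtain ⟨p, hp⟩ := (pathGraph_preconnected n u v).exists_walk_length_eq_dist
    exact hp ▸ hlower p

lemma gridGraph_dist {n m : ℕ} (u v : Fin n × Fin m) :
    (gridGraph n m).dist u v =
      (u.1.1 - v.1.1) + (v.1.1 - u.1.1) + ((u.2.1 - v.2.1) + (v.2.1 - u.2.1)) := by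
  have h1 := pathGraph_preconnected n u.1 v.1
  have h2 := pathGraph_preconnected m u.2 v.2
  rw [← pathGraph_dist, ← pathGraph_dist, gridGraph, SimpleGraph.dist, edist_boxProd,
    ← h1.coe_dist_eq_edist, ← h2.coe_dist_eq_edist, ← Nat.cast_add, ENat.toNat_natCast]

/-- `a`, `b` are the coordinates of a geodesic in the `n × m` grid, parametrised by `0, …, D`,
from each vertex of which one of its endpoints is a farthest vertex of the grid. -/
structure IsSpanningGeodesic (n m D : ℕ) (a b : ℕ → ℕ) : Prop where
  fst_lt : ∀ t ≤ D, a t < n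
  snd_lt : ∀ t ≤ D, b t < m
  dist_eq : ∀ s ≤ D, ∀ t ≤ D,
    (a s - a t) + (a t - a s) + ((b s - b t) + (b t - b s)) = (s - t) + (t - s)
  dist_le : ∀ t ≤ D, ∀ x < n, ∀ y < m,
    (a t - x) + (x - a t) + ((b t - y) + (y - b t)) ≤ max t (D - t)

lemma IsSpanningGeodesic.swap {n m D : ℕ} {a b : ℕ → ℕ} (h : IsSpanningGeodesic n m D a b) :
    IsSpanningGeodesic m n D b a where
  fst_lt := h.snd_lt
  snd_lt := h.fst_lt
  dist_eq s hs t ht := by rw [add_comm, h.dist_eq s hs t ht]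
  dist_le t ht x hx y hy := by rw [add_comm]; exact h.dist_le t ht y hy x hx

lemma IsSpanningGeodesic.reflect {n m D : ℕ} {a b : ℕ → ℕ} (h : IsSpanningGeodesic n m D a b) :
    IsSpanningGeodesic n m D (fun t => n - 1 - a t) b where
  fst_lt t ht := by have := h.fst_lt t ht; omega
  snd_lt := h.snd_lt
  dist_eq s hs t ht := by
    have := h.fst_lt s hs
    have := h.fst_lt t ht
    have := h.dist_eq s hs t ht
    omega
  dist_le t ht x hx y hy := by
    have := h.fst_lt t ht
    have := h.dist_le t ht (n - 1 - x) (by omega) y hy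
    omega

/-- The geodesic through `(i, j)` runs up the first column to height `j`, along that row to the
middle column, up the middle column, and along the last row. -/
lemma exists_isSpanningGeodesic_quadrant {c m i j : ℕ} (hi : i ≤ c) (hj : 2 * j + 1 ≤ m) :
    ∃ a b, IsSpanningGeodesic (2 * c + 1) m (2 * c + m - 1) a b ∧
      ∃ t ≤ 2 * c + m - 1, a t = i ∧ b t = j := by
  obtain ⟨a, ha⟩ : ∃ a : ℕ → ℕ, ∀ t, a t = max (min (t - j) c) (t - (m - 1)) := ⟨_, fun _ => rfl⟩
  have hcases : ∀ t, (t ≤ j ∧ a t = 0 ∧ t - a t = t) ∨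
      (j ≤ t ∧ t ≤ j + c ∧ a t + j = t ∧ t - a t = j) ∨
      (j + c ≤ t ∧ t ≤ c + m - 1 ∧ a t = c ∧ t - a t + c = t) ∨
      (c + m - 1 ≤ t ∧ a t + (m - 1) = t ∧ t - a t = m - 1) := fun t => by
    rw [ha]
    omega
  refine ⟨a, fun t => t - a t, ⟨fun t ht => ?_, fun t ht => ?_, fun s hs t ht => ?_,
    fun t ht x hx y hy => ?_⟩, i + j, by omega, ?_, ?_⟩
  · have := hcases t
    omega
  · have := hcases t
    omega
  · rcases hcases s with h | h | h | h <;> rcases hcases t with h' | h' | h' | h' <;> omega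
  · rcases hcases t with h | h | h | h <;> omega
  · have := hcases (i + j)
    omega
  · have := hcases (i + j)
    simp only
    omega

lemma exists_isSpanningGeodesic_of_odd {n m i j : ℕ} (hn : Odd n) (hi : i < n) (hj : j < m) :
    ∃ a b, IsSpanningGeodesic n m (n + m - 2) a b ∧ ∃ t ≤ n + m - 2, a t = i ∧ b t = j := by
  obtain ⟨c, rfl⟩ := hn
  have hD : 2 * c + 1 + m - 2 = 2 * c + m - 1 := by omega
  rw [hD]
  have hleft : ∀ i ≤ c, ∃ a b, IsSpanningGeodesic (2 * c + 1) m (2 * c + m - 1) a b ∧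
      ∃ t ≤ 2 * c + m - 1, a t = i ∧ b t = j := fun i hi => by
    rcases le_or_gt (2 * j + 1) m with h | h
    · exact exists_isSpanningGeodesic_quadrant hi h
    · obtain ⟨a, b, hab, t, ht, h1, h2⟩ :=
        exists_isSpanningGeodesic_quadrant (m := m) (j := m - 1 - j) hi (by omega)
      exact ⟨a, _, hab.swap.reflect.swap, t, ht, h1, by omega⟩
  rcases le_or_gt i c with h | h
  · exact hleft i h
  · obtain ⟨a, b, hab, t, ht, h1, h2⟩ := hleft (2 * c - i) (by omega)
    exact ⟨_, b, hab.reflect, t, ht, by omega, h2⟩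

lemma exists_isSpanningGeodesic {n m i j : ℕ} (hodd : Odd n ∨ Odd m) (hi : i < n) (hj : j < m) :
    ∃ a b, IsSpanningGeodesic n m (n + m - 2) a b ∧ ∃ t ≤ n + m - 2, a t = i ∧ b t = j := by
  rcases hodd with h | h
  · exact exists_isSpanningGeodesic_of_odd h hi hj
  · obtain ⟨a, b, hab, t, ht, h1, h2⟩ := exists_isSpanningGeodesic_of_odd h hj hi
    rw [add_comm m n] at hab ht
    exact ⟨b, a, hab.swap, t, ht, h2, h1⟩

/-- Every vertex lies in a set of at most `n + m - 1` vertices in which every legal call can be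
answered. -/
lemma exists_answering_set {n m : ℕ} (hodd : Odd n ∨ Odd m) (v : Fin n × Fin m) :
    ∃ U : Set (Fin n × Fin m), v ∈ U ∧ U.ncard ≤ n + m - 1 ∧
      ∀ u ∈ U, ∀ k ≤ ecc (gridGraph n m) u, ∃ x ∈ U, (gridGraph n m).dist u x = k := by
  obtain ⟨a, b, h, t₀, ht₀, h1, h2⟩ := exists_isSpanningGeodesic hodd v.1.2 v.2.2
  have hn := v.1.2
  have hm := v.2.2
  let p : Fin (n + m - 1) → Fin n × Fin m := fun t =>
    (⟨a t, h.fst_lt t (by omega)⟩, ⟨b t, h.snd_lt t (by omega)⟩)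
  refine ⟨Set.range p, ⟨⟨t₀, by omega⟩, Prod.ext (Fin.ext h1) (Fin.ext h2)⟩, ?_, ?_⟩
  · rw [← Set.image_univ]
    exact (Set.ncard_image_le Set.finite_univ).trans (by simp [Set.ncard_univ])
  · rintro _ ⟨t, rfl⟩ k hk
    have hdist : ∀ s, (gridGraph n m).dist (p t) (p s) = (t.1 - s.1) + (s.1 - t.1) := fun s => by
      rw [gridGraph_dist]
      exact h.dist_eq t (by omega) s (by omega)
    have hecc : k ≤ max t.1 (n + m - 2 - t.1) := by
      obtain ⟨w, hw⟩ := exists_dist_eq_ecc (G := gridGraph n m) (p t)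
      rw [← hw, gridGraph_dist] at hk
      exact hk.trans (h.dist_le t (by omega) w.1 w.1.2 w.2 w.2.2)
    by_cases hkt : k ≤ t.1
    · exact ⟨_, ⟨⟨t.1 - k, by omega⟩, rfl⟩, by rw [hdist]; simp only; omega⟩
    · exact ⟨_, ⟨⟨t.1 + k, by omega⟩, rfl⟩, by rw [hdist]; simp only; omega⟩

/-- A vertex of the grid at maximal distance from some vertex is a corner. -/
lemma le_ecc_of_dist_eq_ecc {n m : ℕ} {u w : Fin n × Fin m}
    (h : (gridGraph n m).dist u w = ecc (gridGraph n m) u) :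
    n + m - 2 ≤ ecc (gridGraph n m) w := by
  have hmax : ∀ x : Fin n × Fin m, (gridGraph n m).dist u x ≤ (gridGraph n m).dist u w :=
    fun x => h ▸ dist_le_ecc u x
  have hn := w.1.2
  have hm := w.2.2
  have hend : ∀ {N a b : ℕ}, b < N → (a - 0) + (0 - a) ≤ (a - b) + (b - a) →
      (a - (N - 1)) + (N - 1 - a) ≤ (a - b) + (b - a) → b = 0 ∨ b = N - 1 := by omega
  have h1 := hmax (⟨0, by omega⟩, w.2)
  have h2 := hmax (⟨n - 1, by omega⟩, w.2)
  have h3 := hmax (w.1, ⟨0, by omega⟩)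
  have h4 := hmax (w.1, ⟨m - 1, by omega⟩)
  simp only [gridGraph_dist, add_le_add_iff_right, add_le_add_iff_left] at h1 h2 h3 h4
  have h5 := dist_le_ecc (G := gridGraph n m) w
    (⟨n - 1 - w.1, by omega⟩, ⟨m - 1 - w.2, by omega⟩)
  rw [gridGraph_dist] at h5
  refine le_trans ?_ h5
  rcases hend hn h1 h2 with hw1 | hw1 <;> rcases hend hm h3 h4 with hw2 | hw2 <;>
    simp only [hw1, hw2] <;> omega

end Grid

/-- For `n ≥ m ≥ 2` with at least one of `n, m` odd, every starting vertex
`v` of the grid `L_{n,m}` satisfies `f_d(L_{n,m}, v) = n + m - 1`. -/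
theorem stmt_4 (n m : ℕ) (hm : 2 ≤ m) (hnm : m ≤ n) (hodd : Odd n ∨ Odd m)
    (v : Fin n × Fin m) :
    fd (gridGraph n m) v = n + m - 1 := by
  have hall : ∀ u, ∀ k ≤ ecc (gridGraph n m) u, ∃ x, (gridGraph n m).dist u x = k :=
    fun u k hk => by
      obtain ⟨U, hu, -, hU⟩ := exists_answering_set hodd u
      exact (hU u hu k hk).imp fun _ h => h.2
  have hpos : ∀ u, 1 ≤ ecc (gridGraph n m) u := fun u => by
    have h1 := dist_le_ecc (G := gridGraph n m) u (u.1, ⟨0, by omega⟩)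
    have h2 := dist_le_ecc (G := gridGraph n m) u (u.1, ⟨1, by omega⟩)
    simp only [gridGraph_dist] at h1 h2
    omega
  apply le_antisymm
  · obtain ⟨U, hv, hcard, hU⟩ := exists_answering_set hodd v
    exact (fd_le_ncard hv hpos hU hall).trans hcard
  · have h := succ_le_fd v hpos hall fun _ _ => le_ecc_of_dist_eq_ecc
    omega
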